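/- Let a be a real number with 1/2 < a < 1, let d > 0, set n = 2d(1−a), y₊ = (1/2)·√((2a−1)/(2−a)) and C = ((9−6a)/(8−4a))^{−2(a−1)d/(5d−4ad)}. Then the determinant of the Hessian matrix of F at the point (1, 1, y₊) equals −256·C³·(a−2)⁴·(a−1)³·(2a−1)·d³/(243·(2a−3)⁵); in particular this determinant is negative, so the critical point (1,1,y₊) (corresponding to the Einstein metric g3) is non-degenerate. -/

import Mathlib

open Real

/-- Scalar curvature of the invariant metric `g = (x1,x2,x3,x4)` on `M = H×H/ΔK`,
where `d = dim K` and `n = dim H/K`. -/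
noncomputable def Scal (d n x1 x2 x3 x4 : ℝ) : ℝ :=
  d / (2 * x3) -
    n * (x2 ^ 2 * x3 ^ 2 + x1 ^ 2 * (4 * x2 ^ 2 - 8 * x2 * x3 + x3 ^ 2)
        + 8 * x2 * x3 * x4 ^ 2 + 8 * x1 * x3 * (x4 ^ 2 - x2 ^ 2)
        - 2 * x4 ^ 2 * (x3 ^ 2 + 2 * x4 ^ 2)) /
      (16 * x3 * (x4 ^ 2 - x1 * x2) ^ 2)

/-- Normalized scalar curvature `F(x1,x2,x4) = Scal(x1,x2,1,x4)·(x1·x2 − x4²)^{n/(d+2n)}`. -/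
noncomputable def F (d n x1 x2 x4 : ℝ) : ℝ :=
  Scal d n x1 x2 1 x4 * (x1 * x2 - x4 ^ 2) ^ (n / (d + 2 * n))

/-- Partial derivative of a function of three real variables in the `i`-th variable. -/
noncomputable def pd (i : Fin 3) (f : ℝ → ℝ → ℝ → ℝ) : ℝ → ℝ → ℝ → ℝ :=
  ![fun x y z => deriv (fun t => f t y z) x,
    fun x y z => deriv (fun t => f x t z) y,
    fun x y z => deriv (fun t => f x y t) z] i

/-- Hessian matrix of second-order partial derivatives at `(x, y, z)`. -/
noncomputable def Hess (f : ℝ → ℝ → ℝ → ℝ) (x y z : ℝ) : Matrix (Fin 3) (Fin 3) ℝ :=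
  Matrix.of fun i j => pd i (pd j f) x y z

open Real

/-- `HasPd i f x y z c`: the function `f` of three real variables has partial derivative `c` in
the `i`-th variable at `(x, y, z)`. -/
def HasPd (i : Fin 3) (f : ℝ → ℝ → ℝ → ℝ) (x y z c : ℝ) : Prop :=
  ![HasDerivAt (fun t => f t y z) c x,
    HasDerivAt (fun t => f x t z) c y,
    HasDerivAt (fun t => f x y t) c z] i

theorem HasPd.pd_eq {i : Fin 3} {f : ℝ → ℝ → ℝ → ℝ} {x y z c : ℝ} (h : HasPd i f x y z c) :
    pd i f x y z = c := by
  fin_cases i <;> exact HasDerivAt.deriv h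

/-- The polynomial `x1·x2 − x4²`. -/
def vol (x y z : ℝ) : ℝ := x * y - z ^ 2

/-- The gradient of `vol`. -/
def volGrad (i : Fin 3) (x y z : ℝ) : ℝ := ![y, x, -2 * z] i

/-- The Hessian of `vol`. -/
def volHess : Matrix (Fin 3) (Fin 3) ℝ := !![0, 1, 0; 1, 0, 0; 0, 0, -2]

/-- The polynomial in the numerator of `Scal` at `x3 = 1`. -/
def numer (x y z : ℝ) : ℝ :=
  y ^ 2 + x ^ 2 * (4 * y ^ 2 - 8 * y + 1) + 8 * y * z ^ 2 + 8 * x * (z ^ 2 - y ^ 2)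
    - 2 * z ^ 2 * (1 + 2 * z ^ 2)

/-- The gradient of `numer`. -/
def numerGrad (i : Fin 3) (x y z : ℝ) : ℝ :=
  ![2 * x * (4 * y ^ 2 - 8 * y + 1) + 8 * (z ^ 2 - y ^ 2),
    2 * y + x ^ 2 * (8 * y - 8) + 8 * z ^ 2 - 16 * x * y,
    16 * y * z + 16 * x * z - 4 * z - 16 * z ^ 3] i

/-- The Hessian of `numer`. -/
def numerHess (x y z : ℝ) : Matrix (Fin 3) (Fin 3) ℝ :=
  !![2 * (4 * y ^ 2 - 8 * y + 1), 2 * x * (8 * y - 8) - 16 * y, 16 * z;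
     2 * x * (8 * y - 8) - 16 * y, 2 + 8 * x ^ 2 - 16 * x, 16 * z;
     16 * z, 16 * z, 16 * y + 16 * x - 4 - 48 * z ^ 2]

theorem hasDerivAt_of_eq_quartic {f : ℝ → ℝ} {f' x : ℝ} (c₀ c₁ c₂ c₃ c₄ : ℝ)
    (hf : ∀ t, f t = c₀ + c₁ * t + c₂ * t ^ 2 + c₃ * t ^ 3 + c₄ * t ^ 4)
    (hf' : f' = c₁ + 2 * c₂ * x + 3 * c₃ * x ^ 2 + 4 * c₄ * x ^ 3) : HasDerivAt f f' x := by
  rw [funext hf, hf']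
  have h := ((((hasDerivAt_const x c₀).add ((hasDerivAt_id x).const_mul c₁)).add
    ((hasDerivAt_pow 2 x).const_mul c₂)).add ((hasDerivAt_pow 3 x).const_mul c₃)).add
    ((hasDerivAt_pow 4 x).const_mul c₄)
  refine h.congr_deriv ?_
  norm_num
  ring

theorem hasPd_vol (i : Fin 3) (x y z : ℝ) : HasPd i vol x y z (volGrad i x y z) := by
  fin_cases i
  · exact hasDerivAt_of_eq_quartic (-z ^ 2) y 0 0 0 (fun t => by simp [vol]; ring)
      (by simp [volGrad])
  · exact hasDerivAt_of_eq_quartic (-z ^ 2) x 0 0 0 (fun t => by simp [vol]; ring)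
      (by simp [volGrad])
  · exact hasDerivAt_of_eq_quartic (x * y) 0 (-1) 0 0 (fun t => by simp [vol]; ring)
      (by simp [volGrad])

theorem hasPd_volGrad (i j : Fin 3) (x y z : ℝ) :
    HasPd i (volGrad j) x y z (volHess i j) := by
  fin_cases i <;> fin_cases j
  · exact hasDerivAt_of_eq_quartic y 0 0 0 0 (fun t => by simp [volGrad]) (by simp [volHess])
  · exact hasDerivAt_of_eq_quartic 0 1 0 0 0 (fun t => by simp [volGrad]) (by simp [volHess])
  · exact hasDerivAt_of_eq_quartic (-2 * z) 0 0 0 0 (fun t => by simp [volGrad])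
      (by simp [volHess])
  · exact hasDerivAt_of_eq_quartic 0 1 0 0 0 (fun t => by simp [volGrad]) (by simp [volHess])
  · exact hasDerivAt_of_eq_quartic x 0 0 0 0 (fun t => by simp [volGrad]) (by simp [volHess])
  · exact hasDerivAt_of_eq_quartic (-2 * z) 0 0 0 0 (fun t => by simp [volGrad])
      (by simp [volHess])
  · exact hasDerivAt_of_eq_quartic y 0 0 0 0 (fun t => by simp [volGrad]) (by simp [volHess])
  · exact hasDerivAt_of_eq_quartic x 0 0 0 0 (fun t => by simp [volGrad]) (by simp [volHess])
  · exact hasDerivAt_of_eq_quartic 0 (-2) 0 0 0 (fun t => by simp [volGrad]) (by simp [volHess])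

theorem hasPd_numer (i : Fin 3) (x y z : ℝ) : HasPd i numer x y z (numerGrad i x y z) := by
  fin_cases i
  · exact hasDerivAt_of_eq_quartic (y ^ 2 + 8 * y * z ^ 2 - 2 * z ^ 2 * (1 + 2 * z ^ 2))
      (8 * (z ^ 2 - y ^ 2)) (4 * y ^ 2 - 8 * y + 1) 0 0
      (fun t => by simp [numer]; ring) (by simp [numerGrad]; ring)
  · exact hasDerivAt_of_eq_quartic (x ^ 2 + 8 * x * z ^ 2 - 2 * z ^ 2 * (1 + 2 * z ^ 2))
      (8 * z ^ 2 - 8 * x ^ 2) (1 + 4 * x ^ 2 - 8 * x) 0 0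
      (fun t => by simp [numer]; ring) (by simp [numerGrad]; ring)
  · exact hasDerivAt_of_eq_quartic (y ^ 2 + x ^ 2 * (4 * y ^ 2 - 8 * y + 1) - 8 * x * y ^ 2)
      0 (8 * y + 8 * x - 2) 0 (-4)
      (fun t => by simp [numer]; ring) (by simp [numerGrad]; ring)

theorem hasPd_numerGrad (i j : Fin 3) (x y z : ℝ) :
    HasPd i (numerGrad j) x y z (numerHess x y z i j) := by
  fin_cases i <;> fin_cases j
  · exact hasDerivAt_of_eq_quartic (8 * (z ^ 2 - y ^ 2)) (2 * (4 * y ^ 2 - 8 * y + 1)) 0 0 0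
      (fun t => by simp [numerGrad]; ring) (by simp [numerHess])
  · exact hasDerivAt_of_eq_quartic (2 * y + 8 * z ^ 2) (-16 * y) (8 * y - 8) 0 0
      (fun t => by simp [numerGrad]; ring) (by simp [numerHess]; ring)
  · exact hasDerivAt_of_eq_quartic (16 * y * z - 4 * z - 16 * z ^ 3) (16 * z) 0 0 0
      (fun t => by simp [numerGrad]; ring) (by simp [numerHess])
  · exact hasDerivAt_of_eq_quartic (2 * x + 8 * z ^ 2) (-16 * x) (8 * x - 8) 0 0
      (fun t => by simp [numerGrad]; ring) (by simp [numerHess]; ring)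
  · exact hasDerivAt_of_eq_quartic (8 * z ^ 2 - 8 * x ^ 2) (2 + 8 * x ^ 2 - 16 * x) 0 0 0
      (fun t => by simp [numerGrad]; ring) (by simp [numerHess])
  · exact hasDerivAt_of_eq_quartic (16 * x * z - 4 * z - 16 * z ^ 3) (16 * z) 0 0 0
      (fun t => by simp [numerGrad]; ring) (by simp [numerHess])
  · exact hasDerivAt_of_eq_quartic (2 * x * (4 * y ^ 2 - 8 * y + 1) - 8 * y ^ 2) 0 8 0 0
      (fun t => by simp [numerGrad]; ring) (show 16 * z = _ by ring)
  · exact hasDerivAt_of_eq_quartic (2 * y + x ^ 2 * (8 * y - 8) - 16 * x * y) 0 8 0 0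
      (fun t => by simp [numerGrad]; ring) (show 16 * z = _ by ring)
  · exact hasDerivAt_of_eq_quartic 0 (16 * y + 16 * x - 4) 0 (-16) 0
      (fun t => by simp [numerGrad]; ring) (by simp [numerHess]; ring)

theorem HasPd.congr_of_vol_pos {i : Fin 3} {f g : ℝ → ℝ → ℝ → ℝ} {x y z c : ℝ}
    (h : HasPd i g x y z c) (hU : 0 < vol x y z)
    (hfg : ∀ x y z, 0 < vol x y z → f x y z = g x y z) : HasPd i f x y z c := by
  fin_cases i
  · exact HasDerivAt.congr_of_eventuallyEq h
      (((hasPd_vol 0 x y z : HasDerivAt _ _ _).continuousAt.eventually (lt_mem_nhds hU)).mono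
        fun t ht => hfg _ _ _ ht)
  · exact HasDerivAt.congr_of_eventuallyEq h
      (((hasPd_vol 1 x y z : HasDerivAt _ _ _).continuousAt.eventually (lt_mem_nhds hU)).mono
        fun t ht => hfg _ _ _ ht)
  · exact HasDerivAt.congr_of_eventuallyEq h
      (((hasPd_vol 2 x y z : HasDerivAt _ _ _).continuousAt.eventually (lt_mem_nhds hU)).mono
        fun t ht => hfg _ _ _ ht)

theorem HasDerivAt.mul_rpow_of_pos {k u : ℝ → ℝ} {k' u' x : ℝ} (hk : HasDerivAt k k' x)
    (hu : HasDerivAt u u' x) (hpos : 0 < u x) (q : ℝ) :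
    HasDerivAt (fun t => k t * u t ^ q) ((k' * u x + q * k x * u') * u x ^ (q - 1)) x := by
  refine (hk.mul (hu.rpow_const (p := q) (Or.inl hpos.ne'))).congr_deriv ?_
  have h : u x ^ q = u x ^ (q - 1) * u x := by
    rw [← rpow_add_one hpos.ne', sub_add_cancel]
  rw [h]
  ring

/-- `F` is `potential · vol ^ (p - 2)` with `p = n / (d + 2n)`. -/
noncomputable def potential (d n x y z : ℝ) : ℝ :=
  d / 2 * vol x y z ^ 2 - n / 16 * numer x y z

/-- The gradient of `potential`. -/
noncomputable def potentialGrad (d n : ℝ) (i : Fin 3) (x y z : ℝ) : ℝ :=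
  d * vol x y z * volGrad i x y z - n / 16 * numerGrad i x y z

/-- The Hessian of `potential`. -/
noncomputable def potentialHess (d n x y z : ℝ) (i j : Fin 3) : ℝ :=
  d * (volGrad i x y z * volGrad j x y z + vol x y z * volHess i j)
    - n / 16 * numerHess x y z i j

theorem F_eq_potential_mul (d n x y z : ℝ) (h : 0 < vol x y z) :
    F d n x y z = potential d n x y z * vol x y z ^ (n / (d + 2 * n) - 2) := by
  have hu : x * y - z ^ 2 = vol x y z := rfl
  have h2 : (z ^ 2 - x * y) ^ 2 = vol x y z ^ 2 := by rw [← hu]; ring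
  rw [F, Scal, hu, h2, rpow_sub h, rpow_two, potential, numer]
  field_simp

theorem hasPd_potential (d n : ℝ) (i : Fin 3) (x y z : ℝ) :
    HasPd i (potential d n) x y z (potentialGrad d n i x y z) := by
  have key {u N : ℝ → ℝ} {u' N' t : ℝ} (hu : HasDerivAt u u' t) (hN : HasDerivAt N N' t) :
      HasDerivAt (fun s => d / 2 * u s ^ 2 - n / 16 * N s) (d * u t * u' - n / 16 * N') t := by
    refine (((hu.pow 2).const_mul (d / 2)).sub (hN.const_mul (n / 16))).congr_deriv ?_
    norm_num
    ring
  have hu := hasPd_vol i x y z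
  have hN := hasPd_numer i x y z
  fin_cases i <;> exact key hu hN

theorem hasPd_potentialGrad (d n : ℝ) (i j : Fin 3) (x y z : ℝ) :
    HasPd i (potentialGrad d n j) x y z (potentialHess d n x y z i j) := by
  have key {u v M : ℝ → ℝ} {u' v' M' t : ℝ} (hu : HasDerivAt u u' t) (hv : HasDerivAt v v' t)
      (hM : HasDerivAt M M' t) :
      HasDerivAt (fun s => d * u s * v s - n / 16 * M s)
        (d * (u' * v t + u t * v') - n / 16 * M') t := by
    refine (((hu.const_mul d).mul hv).sub (hM.const_mul (n / 16))).congr_deriv ?_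
    ring
  have hu := hasPd_vol i x y z
  have hv := hasPd_volGrad i j x y z
  have hM := hasPd_numerGrad i j x y z
  fin_cases i <;> exact key hu hv hM

/-- The polynomial factor of the `j`-th partial derivative of `potential · vol ^ q`. -/
noncomputable def gradFactor (d n q : ℝ) (j : Fin 3) (x y z : ℝ) : ℝ :=
  potentialGrad d n j x y z * vol x y z + q * potential d n x y z * volGrad j x y z

/-- The `i`-th partial derivative of `gradFactor d n q j`. -/
noncomputable def gradFactorDeriv (d n q : ℝ) (i j : Fin 3) (x y z : ℝ) : ℝ :=
  potentialHess d n x y z i j * vol x y z + potentialGrad d n j x y z * volGrad i x y z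
    + q * (potentialGrad d n i x y z * volGrad j x y z + potential d n x y z * volHess i j)

theorem hasPd_gradFactor (d n q : ℝ) (i j : Fin 3) (x y z : ℝ) :
    HasPd i (gradFactor d n q j) x y z (gradFactorDeriv d n q i j x y z) := by
  have key {T G u v : ℝ → ℝ} {T' G' u' v' t : ℝ} (hT : HasDerivAt T T' t)
      (hG : HasDerivAt G G' t) (hu : HasDerivAt u u' t) (hv : HasDerivAt v v' t) :
      HasDerivAt (fun s => G s * u s + q * T s * v s)
        (G' * u t + G t * u' + q * (T' * v t + T t * v')) t := by
    refine ((hG.mul hu).add ((hT.const_mul q).mul hv)).congr_deriv ?_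
    ring
  have hT := hasPd_potential d n i x y z
  have hG := hasPd_potentialGrad d n i j x y z
  have hu := hasPd_vol i x y z
  have hv := hasPd_volGrad i j x y z
  fin_cases i <;> exact key hT hG hu hv

theorem HasPd.mul_vol_rpow {i : Fin 3} {k : ℝ → ℝ → ℝ → ℝ} {x y z k' : ℝ}
    (hk : HasPd i k x y z k') (hU : 0 < vol x y z) (q : ℝ) :
    HasPd i (fun x y z => k x y z * vol x y z ^ q) x y z
      ((k' * vol x y z + q * k x y z * volGrad i x y z) * vol x y z ^ (q - 1)) := by
  have hu := hasPd_vol i x y z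
  fin_cases i <;> exact HasDerivAt.mul_rpow_of_pos hk hu hU q

theorem pd_F (d n : ℝ) (j : Fin 3) (x y z : ℝ) (hU : 0 < vol x y z) :
    pd j (F d n) x y z = gradFactor d n (n / (d + 2 * n) - 2) j x y z
      * vol x y z ^ (n / (d + 2 * n) - 3) := by
  have h := ((hasPd_potential d n j x y z).mul_vol_rpow hU (n / (d + 2 * n) - 2)).congr_of_vol_pos
    hU (F_eq_potential_mul d n)
  rw [h.pd_eq, gradFactor, sub_sub]
  norm_num

theorem Hess_F_apply_of_gradFactor_eq_zero (d n : ℝ) (i j : Fin 3) (x y z : ℝ)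
    (hU : 0 < vol x y z) (hcrit : gradFactor d n (n / (d + 2 * n) - 2) j x y z = 0) :
    Hess (F d n) x y z i j = vol x y z ^ (n / (d + 2 * n)) / vol x y z ^ 3
      * gradFactorDeriv d n (n / (d + 2 * n) - 2) i j x y z := by
  have h := ((hasPd_gradFactor d n (n / (d + 2 * n) - 2) i j x y z).mul_vol_rpow hU
    (n / (d + 2 * n) - 3)).congr_of_vol_pos hU (pd_F d n j)
  rw [Hess, Matrix.of_apply, h.pd_eq, hcrit, mul_zero, zero_mul, add_zero, sub_sub,
    rpow_sub hU]
  norm_num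
  field_simp

/-- The determinant of the Hessian of `F` at `(1, 1, y₊)` is negative, so the critical
point corresponding to the Einstein metric `g3` is non-degenerate. -/
theorem g3_hess_det (a d n y C : ℝ) (ha1 : 1/2 < a) (ha2 : a < 1) (hd : 0 < d)
    (hn : n = 2 * d * (1 - a))
    (hy : y = (1/2) * Real.sqrt ((2 * a - 1) / (2 - a)))
    (hC : C = ((9 - 6 * a) / (8 - 4 * a)) ^ (-2 * (a - 1) * d / (5 * d - 4 * a * d))) :
    (Hess (F d n) 1 1 y).det =
      -(256 * C ^ 3 * (a - 2) ^ 4 * (a - 1) ^ 3 * (2 * a - 1) * d ^ 3 /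
        (243 * (2 * a - 3) ^ 5)) ∧
    (Hess (F d n) 1 1 y).det < 0 := by
  have h2a : 0 < 2 - a := by linarith
  have h32 : 0 < 3 - 2 * a := by linarith
  have hy2 : y ^ 2 = (2 * a - 1) / (4 * (2 - a)) := by
    rw [hy, mul_pow, sq_sqrt (div_nonneg (by linarith) h2a.le)]
    field_simp
    ring
  have hs : y ^ 2 < 1 / 4 := by
    rw [hy2, div_lt_div_iff₀ (by positivity) (by norm_num)]
    linarith
  have h1m : 0 < 1 - 2 * y ^ 2 := by linarith
  have hm0 : 1 - y ^ 2 * 2 ≠ 0 := mul_comm 2 (y ^ 2) ▸ h1m.ne'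
  have hD : 0 < 1 - y ^ 2 := by linarith
  have ha : a = (1 + 8 * y ^ 2) / (2 * (1 + 2 * y ^ 2)) := by
    rw [eq_div_iff (by positivity)]
    rw [eq_div_iff (by positivity)] at hy2
    linarith
  have hn' : n = d * (1 - 4 * y ^ 2) / (1 + 2 * y ^ 2) := by
    rw [hn, ha]
    field_simp
    ring
  have hU : 0 < vol 1 1 y := by simpa [vol] using hD
  have hp : n / (d + 2 * n) = (1 - 4 * y ^ 2) / (3 * (1 - 2 * y ^ 2)) := by
    have h : d + 2 * n = 3 * d * (1 - 2 * y ^ 2) / (1 + 2 * y ^ 2) := by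
      rw [hn']
      field_simp
      ring
    rw [h, hn']
    field_simp
  have hq : n / (d + 2 * n) - 2 = (8 * y ^ 2 - 5) / (3 * (1 - 2 * y ^ 2)) := by
    rw [hp]
    field_simp
    ring
  have hCvol : vol 1 1 y ^ (n / (d + 2 * n)) = C := by
    rw [hC, hn, vol, hy2]
    congr 1
    · rw [show 8 - 4 * a = 4 * (2 - a) by ring]
      field_simp
      ring
    · congr 1 <;> ring
  have hCpos : 0 < C := hCvol ▸ rpow_pos_of_pos hU _
  have hT : potential d n 1 1 y =
      9 * d * (1 - y ^ 2) * (1 - 2 * y ^ 2) / (8 * (1 + 2 * y ^ 2)) := by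
    rw [potential, hn', vol, numer]
    field_simp
    ring
  have hG (j : Fin 3) : potentialGrad d n j 1 1 y =
      3 * d * (5 - 8 * y ^ 2) / (8 * (1 + 2 * y ^ 2)) * volGrad j 1 1 y := by
    rw [potentialGrad, hn', vol]
    fin_cases j <;>
    · simp [volGrad, numerGrad]
      field_simp
      ring
  have hcrit (j : Fin 3) : gradFactor d n (n / (d + 2 * n) - 2) j 1 1 y = 0 := by
    rw [gradFactor, hG, hT, hq, vol]
    field_simp
    ring
  have hH (i j : Fin 3) : Hess (F d n) 1 1 y i j = C / (1 - y ^ 2) ^ 2 *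
      (potentialHess d n 1 1 y i j
        - 3 * d * (5 - 8 * y ^ 2) / (8 * (1 + 2 * y ^ 2)) *
          (2 / (3 * (1 - 2 * y ^ 2)) * (volGrad i 1 1 y * volGrad j 1 1 y) + volHess i j)) := by
    rw [Hess_F_apply_of_gradFactor_eq_zero d n i j 1 1 y hU (hcrit j), hCvol, gradFactorDeriv,
      hG, hG, hT, hq, vol, one_mul]
    field_simp
    ring
  have hdet : (Hess (F d n) 1 1 y).det =
      -(256 * C ^ 3 * (a - 2) ^ 4 * (a - 1) ^ 3 * (2 * a - 1) * d ^ 3 /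
        (243 * (2 * a - 3) ^ 5)) := by
    have hr : -(256 * C ^ 3 * (a - 2) ^ 4 * (a - 1) ^ 3 * (2 * a - 1) * d ^ 3 /
        (243 * (2 * a - 3) ^ 5)) = -(C ^ 3 * (1 - 4 * y ^ 2) ^ 3 * y ^ 2 * d ^ 3 /
        (8 * (1 - y ^ 2) ^ 5 * (1 + 2 * y ^ 2) ^ 3)) := by
      have h : 2 * a - 3 = -(2 * (1 - y ^ 2) / (1 + 2 * y ^ 2)) := by
        rw [ha]
        field_simp
        ring
      rw [h, ha]
      field_simp
      ring
    rw [hr, Matrix.det_fin_three]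
    simp only [hH]
    simp only [potentialHess, hn', vol]
    simp [volGrad, volHess, numerHess]
    field_simp
    ring
  refine ⟨hdet, ?_⟩
  rw [hdet, show -(256 * C ^ 3 * (a - 2) ^ 4 * (a - 1) ^ 3 * (2 * a - 1) * d ^ 3 /
      (243 * (2 * a - 3) ^ 5)) = -(256 * C ^ 3 * (2 - a) ^ 4 * (1 - a) ^ 3 * (2 * a - 1) * d ^ 3 /
      (243 * (3 - 2 * a) ^ 5)) by
    rw [show 2 * a - 3 = -(3 - 2 * a) by ring]
    field_simp
    ring]
  have h1 : 0 < 1 - a := by linarith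
  have h3 : 0 < 2 * a - 1 := by linarith
  exact neg_neg_of_pos (by positivity)
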